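/- Let α, ℓ > 0. Assume C > 0 and h₀ ∈ (0,1] are such that for every closed interval Ω ⊂ ℝ of length 1 and every finite X ⊂ ℝ with X ∩ Ω ≠ ∅ and h_{X,Ω} ≤ h₀ one has ∫_Ω P_{ℓ,X}(x) dx ≤ exp(C log(h_{X,Ω}) / h_{X,Ω}). Let c_qu > 0, let (n̄_m)_{m≥1} be a strictly increasing sequence of positive integers, let Y_m ⊂ (0,1) be sets with #Y_m = n̄_m and h_{Y_m,(0,1)} ≤ c_qu/n̄_m, and let X_k be the associated point sets. Set h̄₀ = min{h₀, 1/c_qu} and g(k) = ⌊k + 1 − c_qu/h̄₀⌋. If k ≥ c_qu/h̄₀, then the optimal-weight worst-case error satisfies e^{opt}_{α,ℓ}(X_k) ≤ exp(−g(k)²/(2α²)) + C₁ Σ_{m=k−g(k)+1}^{k} exp(−[(k−m)²/(2α²) + C₂ n̄_m log(n̄_m)]), where C₁ = √2/(√π α) and C₂ = C/(2 c_qu). -/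

import Mathlib

open MeasureTheory Real Filter

noncomputable section

/-- The orthonormal basis functions of the Gaussian RKHS. -/
def phi (ℓ : ℝ) (m : ℕ) (x : ℝ) : ℝ :=
  x ^ m * Real.exp (-x ^ 2 / (2 * ℓ ^ 2)) / (ℓ ^ m * Real.sqrt (Nat.factorial m))

/-- The univariate Gaussian integral functional. -/
def Igauss (α : ℝ) (f : ℝ → ℝ) : ℝ :=
  (Real.sqrt (2 * Real.pi) * α)⁻¹ * ∫ x : ℝ, f x * Real.exp (-x ^ 2 / (2 * α ^ 2))

/-- β = αℓ/√(α² + ℓ²). -/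
def betaP (α ℓ : ℝ) : ℝ := α * ℓ / Real.sqrt (α ^ 2 + ℓ ^ 2)

/-- C_n = 2^n n! n^{−1/4} / √((2n)!). -/
def Cseq (n : ℕ) : ℝ :=
  2 ^ n * (Nat.factorial n : ℝ) * (n : ℝ) ^ (-(1 / 4 : ℝ)) / Real.sqrt (Nat.factorial (2 * n))

/-- ω_γ = 2γ²/(1 + 2γ² + √(1+4γ²)). -/
def omegaP (γ : ℝ) : ℝ := 2 * γ ^ 2 / (1 + 2 * γ ^ 2 + Real.sqrt (1 + 4 * γ ^ 2))

/-- C̄_n(γ). -/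
def Cbar (γ : ℝ) (n : ℕ) : ℝ :=
  Real.sqrt (2 * (1 + 4 * γ ^ 2) ^ ((1 : ℝ) / 4) /
      ((1 + 2 * γ ^ 2 + Real.sqrt (1 + 4 * γ ^ 2)) * Real.exp 1)) *
    ((Nat.factorial n : ℝ) / (Nat.factorial (2 * n) : ℝ)) *
    (Real.exp 1 / (4 * (n : ℝ))) ^ (-(n : ℤ))

/-- `x`, `w` are the nodes and weights of the n-point Gauss–Hermite rule: the nodes are the
n distinct roots of the probabilists' Hermite polynomial H_n, the weights are positive, and
the rule integrates exactly all polynomials of degree at most 2n−1 against the standard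
Gaussian weight. -/
def IsGaussHermite (n : ℕ) (x w : Fin n → ℝ) : Prop :=
  Function.Injective x ∧
  (∀ i, Polynomial.aeval (x i) (Polynomial.hermite n) = 0) ∧
  (∀ i, 0 < w i) ∧
  ∀ p : Polynomial ℝ, p.natDegree ≤ 2 * n - 1 →
    ∑ i, w i * p.eval (x i)
      = (Real.sqrt (2 * Real.pi))⁻¹ * ∫ t : ℝ, p.eval t * Real.exp (-t ^ 2 / 2)

/-- The scaled Gauss–Hermite rule Q_{α,ℓ,n}^{GH}. -/
def QGH (α ℓ : ℝ) {n : ℕ} (x w : Fin n → ℝ) (f : ℝ → ℝ) : ℝ :=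
  betaP α ℓ / α *
    ∑ i, w i * Real.exp (betaP α ℓ ^ 2 * x i ^ 2 / (2 * ℓ ^ 2)) * f (betaP α ℓ * x i)

/-- Membership in the unit ball of the Gaussian RKHS H(K_ℓ). -/
def InBall (ℓ : ℝ) (f : ℝ → ℝ) : Prop :=
  ∃ c : ℕ → ℝ, (∀ x, HasSum (fun m => c m * phi ℓ m x) (f x)) ∧
    Summable (fun m => c m ^ 2) ∧ (∑' m, c m ^ 2) ≤ 1

/-- Worst-case error of a quadrature functional over the unit ball of H(K_ℓ). -/
def wce1 (α ℓ : ℝ) (Q : (ℝ → ℝ) → ℝ) : ℝ :=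
  sSup {e : ℝ | ∃ f : ℝ → ℝ, InBall ℓ f ∧ e = |Igauss α f - Q f|}

/-- The n-th minimal worst-case error (univariate). -/
def minErr1 (α ℓ : ℝ) (n : ℕ) : ℝ :=
  ⨅ p : (Fin n → ℝ) × (Fin n → ℝ), wce1 α ℓ fun f => ∑ i, p.2 i * f (p.1 i)

/-- The multivariate Gaussian integral functional. -/
def IgaussD {d : ℕ} (α : Fin d → ℝ) (f : (Fin d → ℝ) → ℝ) : ℝ :=
  ∫ x : Fin d → ℝ,
    f x * ∏ i, (Real.sqrt (2 * Real.pi) * α i)⁻¹ * Real.exp (-(x i) ^ 2 / (2 * α i ^ 2))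

/-- Membership in the unit ball of the tensor-product Gaussian RKHS H(K_ℓ), ℓ ∈ ℝ^d. -/
def InBallD {d : ℕ} (ℓ : Fin d → ℝ) (f : (Fin d → ℝ) → ℝ) : Prop :=
  ∃ c : (Fin d → ℕ) → ℝ,
    (∀ x, HasSum (fun m => c m * ∏ i, phi (ℓ i) (m i) (x i)) (f x)) ∧
    Summable (fun m => c m ^ 2) ∧ (∑' m, c m ^ 2) ≤ 1

/-- Worst-case error of a multivariate quadrature functional. -/
def wceD {d : ℕ} (α ℓ : Fin d → ℝ) (Q : ((Fin d → ℝ) → ℝ) → ℝ) : ℝ :=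
  sSup {e : ℝ | ∃ f, InBallD ℓ f ∧ e = |IgaussD α f - Q f|}

/-- The N-th minimal worst-case error in dimension d. -/
def minErrD {d : ℕ} (α ℓ : Fin d → ℝ) (N : ℕ) : ℝ :=
  ⨅ p : (Fin N → (Fin d → ℝ)) × (Fin N → ℝ), wceD α ℓ fun f => ∑ i, p.2 i * f (p.1 i)

/-- The tensor-product scaled Gauss–Hermite rule. -/
def QGHD {d : ℕ} (α ℓ : Fin d → ℝ) (n : Fin d → ℕ)
    (x w : ∀ j, Fin (n j) → ℝ) (f : (Fin d → ℝ) → ℝ) : ℝ :=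
  ∑ i : ∀ j, Fin (n j),
    (∏ j, betaP (α j) (ℓ j) / α j * w j (i j) *
        Real.exp (betaP (α j) (ℓ j) ^ 2 * x j (i j) ^ 2 / (2 * ℓ j ^ 2))) *
      f fun j => betaP (α j) (ℓ j) * x j (i j)

/-- The power function of a finite point set (univariate). -/
def power1 (ℓ : ℝ) (X : Finset ℝ) (x : ℝ) : ℝ :=
  sSup {v : ℝ | ∃ f, InBall ℓ f ∧ (∀ y ∈ X, f y = 0) ∧ v = f x}

/-- Fill distance of X on Ω (univariate). -/
def fillDist1 (X : Finset ℝ) (Ω : Set ℝ) : ℝ :=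
  sSup {h : ℝ | ∃ x ∈ Ω, h = sInf {r : ℝ | ∃ y ∈ X, y ∈ Ω ∧ r = |x - y|}}

/-- Euclidean distance on ℝ^d. -/
def eucDist {d : ℕ} (x y : Fin d → ℝ) : ℝ := Real.sqrt (∑ i, (x i - y i) ^ 2)

/-- The power function of a finite point set in ℝ^d for the isotropic Gaussian kernel. -/
def powerD {d : ℕ} (ℓ : ℝ) (X : Finset (Fin d → ℝ)) (x : Fin d → ℝ) : ℝ :=
  sSup {v : ℝ | ∃ f, InBallD (fun _ => ℓ) f ∧ (∀ y ∈ X, f y = 0) ∧ v = f x}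

/-- Fill distance of X on Ω ⊂ ℝ^d (Euclidean). -/
def fillDistD {d : ℕ} (X : Finset (Fin d → ℝ)) (Ω : Set (Fin d → ℝ)) : ℝ :=
  sSup {h : ℝ | ∃ x ∈ Ω, h = sInf {r : ℝ | ∃ y ∈ X, y ∈ Ω ∧ r = eucDist x y}}

/-- Worst-case error of the optimal-weight (kernel quadrature) rule with nodes X (univariate). -/
def eopt1 (α ℓ : ℝ) (X : Finset ℝ) : ℝ :=
  ⨅ w : ℝ → ℝ, wce1 α ℓ fun f => ∑ y ∈ X, w y * f y

/-- Worst-case error of the optimal-weight rule with nodes X ⊂ ℝ^d. -/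
def eoptD {d : ℕ} (α ℓ : Fin d → ℝ) (X : Finset (Fin d → ℝ)) : ℝ :=
  ⨅ w : (Fin d → ℝ) → ℝ, wceD α ℓ fun f => ∑ y ∈ X, w y * f y

/-- The point sets X_k = ∪_{m=1}^k (Y_{k−m+1}^{m,+} ∪ Y_{k−m+1}^{m,−}). -/
def Xk (Y : ℕ → Finset ℝ) (k : ℕ) : Finset ℝ :=
  (Finset.Icc 1 k).biUnion fun m =>
    ((Y (k - m + 1)).image fun x => x + (m : ℝ) - 1) ∪
      ((Y (k - m + 1)).image fun x => x - (m : ℝ))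


/-- The sequence space in which the coefficients of an element of the RKHS live. -/
abbrev CoeffSpace : Type := lp (fun _ : ℕ => ℝ) 2

lemma hasSum_phi_mul_phi {ℓ : ℝ} (hℓ : 0 < ℓ) (x y : ℝ) :
    HasSum (fun m => phi ℓ m x * phi ℓ m y) (Real.exp (-(x - y) ^ 2 / (2 * ℓ ^ 2))) := by
  have h := (NormedSpace.expSeries_div_hasSum_exp (x * y / ℓ ^ 2)).mul_left
    (Real.exp (-(x ^ 2 + y ^ 2) / (2 * ℓ ^ 2)))
  rw [← Real.exp_eq_exp_ℝ, ← Real.exp_add] at h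
  convert! h using 1
  · funext m
    have hs : Real.sqrt (m.factorial : ℝ) * Real.sqrt (m.factorial : ℝ) = m.factorial :=
      Real.mul_self_sqrt (by positivity)
    have he : Real.exp (-(x ^ 2 + y ^ 2) / (2 * ℓ ^ 2)) =
        Real.exp (-x ^ 2 / (2 * ℓ ^ 2)) * Real.exp (-y ^ 2 / (2 * ℓ ^ 2)) := by
      rw [← Real.exp_add]; congr 1; ring
    rw [he, phi, phi, div_mul_div_comm, ← mul_div_assoc, div_pow, mul_div_assoc',
      div_div, mul_mul_mul_comm (ℓ ^ m), hs]
    congr 1 <;> ring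
  · congr 1
    field_simp
    ring

lemma memℓp_two_of_summable_sq {c : ℕ → ℝ} (hc : Summable fun m => c m ^ 2) :
    Memℓp c 2 := by
  refine memℓp_gen ?_
  simpa using hc

/-- The canonical feature map of the Gaussian kernel: the coefficients of `K_ℓ(x, ·)`. -/
def feature {ℓ : ℝ} (hℓ : 0 < ℓ) (x : ℝ) : CoeffSpace :=
  ⟨fun m => phi ℓ m x, memℓp_two_of_summable_sq <| by
    simpa only [pow_two] using (hasSum_phi_mul_phi hℓ x x).summable⟩

lemma hasSum_inner_feature {ℓ : ℝ} (hℓ : 0 < ℓ) (c : CoeffSpace) (x : ℝ) :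
    HasSum (fun m => c m * phi ℓ m x) (inner ℝ c (feature hℓ x)) := by
  convert! lp.hasSum_inner (𝕜 := ℝ) c (feature hℓ x) using 2
  simp [feature, mul_comm]

lemma hasSum_sq_norm (c : CoeffSpace) : HasSum (fun m => c m ^ 2) (‖c‖ ^ 2) := by
  rw [← real_inner_self_eq_norm_sq]
  convert! lp.hasSum_inner (𝕜 := ℝ) c c using 2
  simp [pow_two]

lemma inner_feature_feature {ℓ : ℝ} (hℓ : 0 < ℓ) (x y : ℝ) :
    inner ℝ (feature hℓ x) (feature hℓ y) = Real.exp (-(x - y) ^ 2 / (2 * ℓ ^ 2)) :=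
  (hasSum_inner_feature hℓ (feature hℓ x) y).unique (hasSum_phi_mul_phi hℓ x y)

lemma norm_feature {ℓ : ℝ} (hℓ : 0 < ℓ) (x : ℝ) : ‖feature hℓ x‖ = 1 := by
  have h := inner_feature_feature hℓ x x
  rw [real_inner_self_eq_norm_sq] at h
  rwa [sub_self, zero_pow two_ne_zero, neg_zero, zero_div, Real.exp_zero,
    pow_eq_one_iff_of_nonneg (norm_nonneg _) two_ne_zero] at h

lemma continuous_feature {ℓ : ℝ} (hℓ : 0 < ℓ) : Continuous (feature hℓ) := by
  rw [continuous_iff_continuousAt]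
  intro x
  rw [ContinuousAt, tendsto_iff_norm_sub_tendsto_zero]
  have h : ∀ y, ‖feature hℓ y - feature hℓ x‖ =
      Real.sqrt (2 - 2 * Real.exp (-(y - x) ^ 2 / (2 * ℓ ^ 2))) := fun y => by
    rw [← Real.sqrt_sq (norm_nonneg (feature hℓ y - feature hℓ x)), @norm_sub_sq_real,
      norm_feature, norm_feature, inner_feature_feature]
    congr 1
    ring
  simp only [h]
  have hc : Continuous fun y : ℝ =>
      Real.sqrt (2 - 2 * Real.exp (-(y - x) ^ 2 / (2 * ℓ ^ 2))) := by fun_prop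
  simpa using hc.tendsto x

lemma inBall_iff {ℓ : ℝ} (hℓ : 0 < ℓ) {f : ℝ → ℝ} :
    InBall ℓ f ↔ ∃ c : CoeffSpace, ‖c‖ ≤ 1 ∧ ∀ x, f x = inner ℝ c (feature hℓ x) := by
  constructor
  · rintro ⟨c, hf, hs, hc⟩
    let d : CoeffSpace := ⟨c, memℓp_two_of_summable_sq hs⟩
    refine ⟨d, ?_, fun x => (hf x).unique (hasSum_inner_feature hℓ d x)⟩
    have h : ‖d‖ ^ 2 ≤ 1 := (hasSum_sq_norm d).tsum_eq ▸ hc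
    exact (sq_le_one_iff₀ (norm_nonneg d)).1 h
  · rintro ⟨c, hc, hf⟩
    refine ⟨c, fun x => hf x ▸ hasSum_inner_feature hℓ c x, (hasSum_sq_norm c).summable, ?_⟩
    rw [(hasSum_sq_norm c).tsum_eq]
    exact (sq_le_one_iff₀ (norm_nonneg c)).2 hc

lemma abs_inner_feature_le {ℓ : ℝ} (hℓ : 0 < ℓ) (c : CoeffSpace) (x : ℝ) :
    |inner ℝ c (feature hℓ x)| ≤ ‖c‖ := by
  simpa [norm_feature] using abs_real_inner_le_norm c (feature hℓ x)

lemma InBall.continuous {ℓ : ℝ} (hℓ : 0 < ℓ) {f : ℝ → ℝ} (hf : InBall ℓ f) :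
    Continuous f := by
  obtain ⟨c, -, hc⟩ := (inBall_iff hℓ).1 hf
  rw [funext hc]
  exact continuous_const.inner (continuous_feature hℓ)

lemma InBall.abs_le_one {ℓ : ℝ} (hℓ : 0 < ℓ) {f : ℝ → ℝ} (hf : InBall ℓ f) (x : ℝ) :
    |f x| ≤ 1 := by
  obtain ⟨c, hc1, hc⟩ := (inBall_iff hℓ).1 hf
  rw [hc]
  exact (abs_inner_feature_le hℓ c x).trans hc1

lemma InBall.neg {ℓ : ℝ} (hℓ : 0 < ℓ) {f : ℝ → ℝ} (hf : InBall ℓ f) :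
    InBall ℓ fun x => -f x := by
  obtain ⟨c, hc1, hc⟩ := (inBall_iff hℓ).1 hf
  exact (inBall_iff hℓ).2 ⟨-c, by rwa [norm_neg], fun x => by rw [inner_neg_left, hc]⟩

lemma inBall_zero (ℓ : ℝ) : InBall ℓ fun _ => 0 :=
  ⟨fun _ => 0, by simp⟩

lemma bddAbove_power1_set {ℓ : ℝ} (hℓ : 0 < ℓ) (X : Finset ℝ) (x : ℝ) :
    BddAbove {v : ℝ | ∃ f, InBall ℓ f ∧ (∀ y ∈ X, f y = 0) ∧ v = f x} := by
  refine ⟨1, ?_⟩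
  rintro _ ⟨f, hf, -, rfl⟩
  exact (le_abs_self _).trans (hf.abs_le_one hℓ x)

lemma abs_le_power1 {ℓ : ℝ} (hℓ : 0 < ℓ) {X : Finset ℝ} {f : ℝ → ℝ} (hf : InBall ℓ f)
    (hX : ∀ y ∈ X, f y = 0) (x : ℝ) : |f x| ≤ power1 ℓ X x :=
  abs_le'.2 ⟨le_csSup (bddAbove_power1_set hℓ X x) ⟨f, hf, hX, rfl⟩,
    le_csSup (bddAbove_power1_set hℓ X x)
      ⟨fun x => -f x, hf.neg hℓ, fun y hy => neg_eq_zero.2 (hX y hy), rfl⟩⟩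

lemma power1_nonneg {ℓ : ℝ} (hℓ : 0 < ℓ) (X : Finset ℝ) (x : ℝ) : 0 ≤ power1 ℓ X x := by
  simpa using abs_le_power1 hℓ (inBall_zero ℓ) (fun _ _ => rfl) x

lemma power1_le_one {ℓ : ℝ} (hℓ : 0 < ℓ) (X : Finset ℝ) (x : ℝ) : power1 ℓ X x ≤ 1 := by
  refine Real.sSup_le ?_ zero_le_one
  rintro _ ⟨f, hf, -, rfl⟩
  exact (le_abs_self _).trans (hf.abs_le_one hℓ x)

lemma measurable_power1 {ℓ : ℝ} (hℓ : 0 < ℓ) (X : Finset ℝ) : Measurable (power1 ℓ X) := by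
  refine LowerSemicontinuous.measurable fun x y hy => ?_
  have hne : {v : ℝ | ∃ f, InBall ℓ f ∧ (∀ y ∈ X, f y = 0) ∧ v = f x}.Nonempty :=
    ⟨0, fun _ => 0, inBall_zero ℓ, fun _ _ => rfl, rfl⟩
  obtain ⟨_, ⟨f, hf, hX, rfl⟩, hyf⟩ := exists_lt_of_lt_csSup hne hy
  filter_upwards [(hf.continuous hℓ).continuousAt.eventually_const_lt hyf] with z hz
  exact hz.trans_le (le_csSup (bddAbove_power1_set hℓ X z) ⟨f, hf, hX, rfl⟩)

lemma setIntegral_abs_le_setIntegral_power1 {ℓ : ℝ} (hℓ : 0 < ℓ) {X : Finset ℝ} {f : ℝ → ℝ}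
    (hf : InBall ℓ f) (hX : ∀ y ∈ X, f y = 0) (a b : ℝ) :
    ∫ x in Set.Icc a b, |f x| ≤ ∫ x in Set.Icc a b, power1 ℓ X x := by
  refine setIntegral_mono ((hf.continuous hℓ).abs.integrableOn_Icc) ?_
    (abs_le_power1 hℓ hf hX)
  refine Measure.integrableOn_of_bounded (M := 1) (by simp)
    (measurable_power1 hℓ X).aestronglyMeasurable (Eventually.of_forall fun x => ?_)
  rw [Real.norm_of_nonneg (power1_nonneg hℓ X x)]
  exact power1_le_one hℓ X x

lemma integrable_gauss {α : ℝ} (hα : 0 < α) :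
    Integrable fun x : ℝ => Real.exp (-x ^ 2 / (2 * α ^ 2)) := by
  convert integrable_exp_neg_mul_sq (b := 1 / (2 * α ^ 2)) (by positivity) using 3
  ring

lemma integral_gauss_Ioi {α : ℝ} (hα : 0 < α) :
    ∫ x in Set.Ioi (0 : ℝ), Real.exp (-x ^ 2 / (2 * α ^ 2)) = Real.sqrt (2 * π) * α / 2 := by
  have h := integral_gaussian_Ioi (1 / (2 * α ^ 2))
  have e : π / (1 / (2 * α ^ 2)) = 2 * π * α ^ 2 := by field_simp
  rw [e, Real.sqrt_mul (by positivity), Real.sqrt_sq hα.le] at h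
  rw [← h]
  congr 1
  funext x
  congr 1
  ring

lemma integrable_mul_gauss {α M : ℝ} (hα : 0 < α) {f : ℝ → ℝ} (hf : Continuous f)
    (hM : ∀ x, |f x| ≤ M) : Integrable fun x => f x * Real.exp (-x ^ 2 / (2 * α ^ 2)) :=
  (integrable_gauss hα).bdd_mul hf.aestronglyMeasurable (Eventually.of_forall hM)

/-- The Gaussian integral as a bounded functional of the coefficients. -/
lemma exists_igauss_eq_inner {α ℓ : ℝ} (hα : 0 < α) (hℓ : 0 < ℓ) :
    ∃ r : CoeffSpace, ∀ c : CoeffSpace,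
      Igauss α (fun x => inner ℝ c (feature hℓ x)) = inner ℝ r c := by
  have hint : ∀ c : CoeffSpace, Integrable fun x =>
      inner ℝ c (feature hℓ x) * Real.exp (-x ^ 2 / (2 * α ^ 2)) := fun c =>
    integrable_mul_gauss hα (continuous_const.inner (continuous_feature hℓ))
      (abs_inner_feature_le hℓ c)
  let L : CoeffSpace →ₗ[ℝ] ℝ :=
    { toFun := fun c => Igauss α fun x => inner ℝ c (feature hℓ x)
      map_add' := fun c d => by
        simp only [Igauss, inner_add_left, add_mul]
        rw [integral_add (hint c) (hint d), mul_add]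
      map_smul' := fun a c => by
        simp only [Igauss, real_inner_smul_left, mul_assoc, RingHom.id_apply, smul_eq_mul]
        rw [integral_const_mul]
        ring }
  have hb : ∀ c, ‖L c‖ ≤ ((Real.sqrt (2 * π) * α)⁻¹ *
      ∫ x : ℝ, Real.exp (-x ^ 2 / (2 * α ^ 2))) * ‖c‖ := fun c => by
    change ‖(Real.sqrt (2 * π) * α)⁻¹ * ∫ x : ℝ, _‖ ≤ _
    rw [norm_mul, Real.norm_of_nonneg (by positivity), mul_assoc]
    gcongr
    rw [← integral_mul_const]
    refine norm_integral_le_of_norm_le ((integrable_gauss hα).mul_const _)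
      (Eventually.of_forall fun x => ?_)
    rw [norm_mul, Real.norm_of_nonneg (Real.exp_pos _).le, mul_comm]
    gcongr
    exact abs_inner_feature_le hℓ c x
  exact ⟨(InnerProductSpace.toDual ℝ CoeffSpace).symm (L.mkContinuous _ hb), fun c => by
    rw [InnerProductSpace.toDual_symm_apply]; rfl⟩

/-- The optimal worst-case error is at most the supremum of the integral over those elements of
the unit ball that vanish at the nodes. -/
lemma eopt1_le_of_forall_vanishing {α ℓ : ℝ} (hα : 0 < α) (hℓ : 0 < ℓ) (X : Finset ℝ) {B : ℝ}
    (hB : ∀ f, InBall ℓ f → (∀ y ∈ X, f y = 0) → |Igauss α f| ≤ B) :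
    eopt1 α ℓ X ≤ B := by
  obtain ⟨r, hr⟩ := exists_igauss_eq_inner hα hℓ
  have hB0 : 0 ≤ B := (abs_nonneg _).trans (hB _ (inBall_zero ℓ) fun _ _ => rfl)
  let V : Submodule ℝ CoeffSpace := Submodule.span ℝ (feature hℓ '' (X : Set ℝ))
  have : FiniteDimensional ℝ V :=
    FiniteDimensional.span_of_finite ℝ (X.finite_toSet.image _)
  obtain ⟨p, hp, u, hu, hru⟩ := V.exists_add_mem_mem_orthogonal r
  have huX : ∀ y ∈ X, inner ℝ u (feature hℓ y) = 0 := fun y hy => by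
    rw [real_inner_comm]
    exact hu _ (Submodule.subset_span ⟨y, hy, rfl⟩)
  have hur : inner ℝ r u = ‖u‖ ^ 2 := by
    rw [hru, inner_add_left, hu p hp, real_inner_self_eq_norm_sq, zero_add]
  have hnorm : ‖u‖ ≤ B := by
    rcases eq_or_ne u 0 with h0 | h0
    · simpa [h0] using hB0
    have hn : 0 < ‖u‖ := norm_pos_iff.2 h0
    have h := hB (fun x => inner ℝ (‖u‖⁻¹ • u) (feature hℓ x))
      ((inBall_iff hℓ).2 ⟨‖u‖⁻¹ • u, by rw [norm_smul, norm_inv, norm_norm, inv_mul_cancel₀ hn.ne'],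
        fun _ => rfl⟩)
      (fun y hy => by rw [real_inner_smul_left, huX y hy, mul_zero])
    rw [hr, real_inner_smul_right, hur, pow_two, ← mul_assoc, inv_mul_cancel₀ hn.ne', one_mul] at h
    exact (le_abs_self _).trans h
  obtain ⟨w, hw⟩ := (Submodule.mem_span_image_finset_iff_exists_fun' ℝ).1 hp
  have hbdd : BddBelow (Set.range fun w : ℝ → ℝ =>
      wce1 α ℓ fun f => ∑ y ∈ X, w y * f y) := by
    refine ⟨0, ?_⟩
    rintro _ ⟨w, rfl⟩
    refine Real.sSup_nonneg ?_
    rintro _ ⟨f, -, rfl⟩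
    exact abs_nonneg _
  refine (ciInf_le hbdd w).trans (Real.sSup_le ?_ hB0)
  rintro _ ⟨f, hf, rfl⟩
  obtain ⟨c, hc, hfc⟩ := (inBall_iff hℓ).1 hf
  have hsum : ∑ y ∈ X, w y * f y = inner ℝ p c := by
    rw [← hw, sum_inner]
    exact Finset.sum_congr rfl fun y _ => by rw [real_inner_smul_left, hfc, real_inner_comm]
  beta_reduce
  rw [hsum, funext hfc, hr, ← inner_sub_left, hru, add_sub_cancel_left]
  calc |inner ℝ u c| ≤ ‖u‖ * ‖c‖ := abs_real_inner_le_norm u c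
    _ ≤ B * 1 := by gcongr
    _ = B := mul_one B

lemma sInf_dist_le {X : Finset ℝ} {Ω : Set ℝ} {y : ℝ} (hy : y ∈ X) (hyΩ : y ∈ Ω) (x : ℝ) :
    sInf {r : ℝ | ∃ y ∈ X, y ∈ Ω ∧ r = |x - y|} ≤ |x - y| := by
  refine csInf_le ⟨0, ?_⟩ ⟨y, hy, hyΩ, rfl⟩
  rintro _ ⟨z, -, -, rfl⟩
  exact abs_nonneg _

lemma sInf_dist_le_fillDist1 {X : Finset ℝ} {a b : ℝ} {Ω : Set ℝ} (hΩ : Ω ⊆ Set.Icc a b) {x y : ℝ}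
    (hy : y ∈ X) (hyΩ : y ∈ Ω) (hx : x ∈ Ω) :
    sInf {r : ℝ | ∃ y ∈ X, y ∈ Ω ∧ r = |x - y|} ≤ fillDist1 X Ω := by
  refine le_csSup ⟨b - a, ?_⟩ ⟨x, hx, rfl⟩
  rintro _ ⟨z, hz, rfl⟩
  refine (sInf_dist_le hy hyΩ z).trans ?_
  have h1 := hΩ hz
  have h2 := hΩ hyΩ
  rw [abs_le]
  constructor <;> linarith [h1.1, h1.2, h2.1, h2.2]

lemma fillDist1_Icc_pos {X : Finset ℝ} {a b y : ℝ} (hab : a < b) (hy : y ∈ X)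
    (hyI : y ∈ Set.Icc a b) : 0 < fillDist1 X (Set.Icc a b) := by
  obtain ⟨x, hxI, hxX⟩ := (Set.Icc_infinite hab).exists_notMem_finset X
  refine lt_of_lt_of_le ?_ (sInf_dist_le_fillDist1 subset_rfl hy hyI hxI)
  have hfin : {r : ℝ | ∃ y ∈ X, y ∈ Set.Icc a b ∧ r = |x - y|}.Finite := by
    refine (X.finite_toSet.image fun y => |x - y|).subset ?_
    rintro _ ⟨z, hz, -, rfl⟩
    exact ⟨z, hz, rfl⟩
  have hne : {r : ℝ | ∃ y ∈ X, y ∈ Set.Icc a b ∧ r = |x - y|}.Nonempty := ⟨_, y, hy, hyI, rfl⟩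
  obtain ⟨z, hz, -, h⟩ := hne.csInf_mem hfin
  rw [h, abs_pos, sub_ne_zero]
  rintro rfl
  exact hxX hz

/-- Passing to a translate, to a larger point set and to the closed interval does not increase
the fill distance. -/
lemma fillDist1_Icc_le_of_translate {X Y : Finset ℝ} {a : ℝ} (hY : (Y : Set ℝ) ⊆ Set.Ioo 0 1)
    (hne : Y.Nonempty) (hsub : ∀ y ∈ Y, y + a ∈ X) :
    fillDist1 X (Set.Icc a (a + 1)) ≤ fillDist1 Y (Set.Ioo 0 1) := by
  obtain ⟨y₀, hy₀⟩ := hne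
  refine csSup_le ⟨_, a, ⟨le_rfl, by linarith⟩, rfl⟩ ?_
  rintro _ ⟨x, hx, rfl⟩
  refine le_of_forall_pos_le_add fun ε hε => ?_
  have hcl : x - a ∈ closure (Set.Ioo (0 : ℝ) 1) := by
    rw [closure_Ioo zero_ne_one]
    exact ⟨by linarith [hx.1], by linarith [hx.2]⟩
  obtain ⟨t, ht, hxt⟩ := Metric.mem_closure_iff.1 hcl (ε / 2) (half_pos hε)
  have hne : {r : ℝ | ∃ y ∈ Y, y ∈ Set.Ioo (0 : ℝ) 1 ∧ r = |t - y|}.Nonempty :=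
    ⟨_, y₀, hy₀, hY hy₀, rfl⟩
  obtain ⟨_, ⟨y, hy, -, rfl⟩, hty⟩ := exists_lt_of_csInf_lt hne
    ((sInf_dist_le_fillDist1 Set.Ioo_subset_Icc_self hy₀ (hY hy₀) ht).trans_lt
      (lt_add_of_pos_right _ (half_pos hε)))
  have hy1 := hY hy
  have hya : y + a ∈ Set.Icc a (a + 1) := ⟨by linarith [hy1.1], by linarith [hy1.2]⟩
  refine (sInf_dist_le (hsub y hy) hya x).trans ?_
  have h := abs_add_le (x - a - t) (t - y)
  rw [Real.dist_eq] at hxt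
  rw [show x - (y + a) = x - a - t + (t - y) by ring]
  linarith

lemma log_div_self_le {s t : ℝ} (hs : 0 < s) (hst : s ≤ t) (ht : t ≤ 1) :
    Real.log s / s ≤ Real.log t / t := by
  have ht0 : 0 < t := hs.trans_le hst
  have hlt : Real.log t ≤ 0 := Real.log_nonpos ht0.le ht
  calc Real.log s / s ≤ Real.log t / s := by gcongr
    _ ≤ Real.log t / t := by
      rw [div_le_div_iff₀ hs ht0]
      exact mul_le_mul_of_nonpos_left hst hlt

lemma exp_log_div_le {C c h n : ℝ} (hC : 0 < C) (hc : 0 < c) (hn : 0 < n) (h0 : 0 < h)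
    (hh : h ≤ c / n) (hcn : c ≤ n) (hcn2 : c ^ 2 ≤ n) :
    Real.exp (C * Real.log h / h) ≤ Real.exp (-(C / (2 * c) * n * Real.log n)) := by
  rw [Real.exp_le_exp, mul_div_assoc]
  have h1 := log_div_self_le h0 hh ((div_le_one hn).2 hcn)
  rw [Real.log_div hc.ne' hn.ne'] at h1
  have h2 : 2 * Real.log c ≤ Real.log n := by
    simpa using Real.log_le_log (by positivity) hcn2
  calc C * (Real.log h / h) ≤ C * ((Real.log c - Real.log n) / (c / n)) := by gcongr
    _ ≤ C * ((-(Real.log n / 2)) / (c / n)) := by gcongr; linarith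
    _ = -(C / (2 * c) * n * Real.log n) := by field_simp

/-- Bound for the Gaussian-weighted integral over a half-line of a function bounded by one whose
integrals over the first `g` unit intervals are controlled. -/
lemma setIntegral_Ioi_abs_mul_gauss_le {α : ℝ} (hα : 0 < α) {f : ℝ → ℝ} (hf : Continuous f)
    (h1 : ∀ x, |f x| ≤ 1) (g : ℕ) {B : ℕ → ℝ}
    (hB : ∀ q < g, ∫ x in (q : ℝ)..(q : ℝ) + 1, |f x| ≤ B q) :
    ∫ x in Set.Ioi (0 : ℝ), |f x| * Real.exp (-x ^ 2 / (2 * α ^ 2)) ≤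
      (∑ q ∈ Finset.range g, Real.exp (-(q : ℝ) ^ 2 / (2 * α ^ 2)) * B q) +
        Real.exp (-(g : ℝ) ^ 2 / (2 * α ^ 2)) * (Real.sqrt (2 * π) * α / 2) := by
  have hcont : Continuous fun x => |f x| * Real.exp (-x ^ 2 / (2 * α ^ 2)) := by fun_prop
  have hint : Integrable fun x => |f x| * Real.exp (-x ^ 2 / (2 * α ^ 2)) :=
    integrable_mul_gauss hα hf.abs fun x => by simpa using h1 x
  rw [← intervalIntegral.integral_interval_add_Ioi hint.integrableOn hint.integrableOn (b := (g : ℝ))]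
  refine add_le_add ?_ ?_
  · have hs := intervalIntegral.sum_integral_adjacent_intervals (μ := volume)
      (f := fun x => |f x| * Real.exp (-x ^ 2 / (2 * α ^ 2))) (a := fun q : ℕ => (q : ℝ)) (n := g)
      fun q _ => hcont.intervalIntegrable _ _
    rw [Nat.cast_zero] at hs
    rw [← hs]
    refine Finset.sum_le_sum fun q hq => ?_
    push_cast
    calc ∫ x in (q : ℝ)..(q : ℝ) + 1, |f x| * Real.exp (-x ^ 2 / (2 * α ^ 2))
        ≤ ∫ x in (q : ℝ)..(q : ℝ) + 1, Real.exp (-(q : ℝ) ^ 2 / (2 * α ^ 2)) * |f x| := by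
          refine intervalIntegral.integral_mono_on (by linarith) (hcont.intervalIntegrable _ _)
            ((hf.abs.const_mul _).intervalIntegrable _ _) fun x hx => ?_
          rw [mul_comm]
          have := hx.1
          gcongr
      _ ≤ _ := by
          rw [intervalIntegral.integral_const_mul]
          gcongr
          exact hB q (Finset.mem_range.1 hq)
  · have hshift := (measurePreserving_add_right volume (g : ℝ)).setIntegral_preimage_emb
      (measurableEmbedding_addRight (g : ℝ))
      (fun x => |f x| * Real.exp (-x ^ 2 / (2 * α ^ 2))) (Set.Ioi (g : ℝ))
    rw [Set.preimage_add_const_Ioi, sub_self] at hshift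
    rw [← hshift, ← integral_gauss_Ioi hα, ← integral_const_mul]
    refine setIntegral_mono_on (hint.comp_add_right (g : ℝ)).integrableOn
      ((integrable_gauss hα).const_mul _).integrableOn measurableSet_Ioi fun x hx => ?_
    rw [← Real.exp_add]
    refine (mul_le_of_le_one_left (Real.exp_pos _).le (h1 _)).trans ?_
    rw [Real.exp_le_exp, ← add_div]
    have : (0 : ℝ) < x := hx
    gcongr
    nlinarith [mul_nonneg this.le (Nat.cast_nonneg (α := ℝ) g)]

/-- Two-sided version of `setIntegral_Ioi_abs_mul_gauss_le` for the Gaussian integral. -/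
lemma abs_Igauss_le {α : ℝ} (hα : 0 < α) {f : ℝ → ℝ} (hf : Continuous f)
    (h1 : ∀ x, |f x| ≤ 1) (g : ℕ) {B : ℕ → ℝ}
    (hpos : ∀ q < g, ∫ x in (q : ℝ)..(q : ℝ) + 1, |f x| ≤ B q)
    (hneg : ∀ q < g, ∫ x in (-(q + 1) : ℝ)..-q, |f x| ≤ B q) :
    |Igauss α f| ≤ Real.exp (-(g : ℝ) ^ 2 / (2 * α ^ 2)) +
      (Real.sqrt 2 / (Real.sqrt π * α)) *
        ∑ q ∈ Finset.range g, Real.exp (-(q : ℝ) ^ 2 / (2 * α ^ 2)) * B q := by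
  have hint : Integrable fun x => |f x| * Real.exp (-x ^ 2 / (2 * α ^ 2)) :=
    integrable_mul_gauss hα hf.abs fun x => by simpa using h1 x
  have hP := setIntegral_Ioi_abs_mul_gauss_le hα hf h1 g hpos
  have hN := setIntegral_Ioi_abs_mul_gauss_le hα (f := fun x => f (-x)) (by fun_prop)
    (fun x => h1 _) g (B := B) fun q hq => by
      rw [intervalIntegral.integral_comp_neg (fun x => |f x|)]
      exact hneg q hq
  have hrefl := integral_comp_neg_Ioi 0 fun x => |f x| * Real.exp (-x ^ 2 / (2 * α ^ 2))
  simp only [neg_sq, neg_zero] at hrefl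
  rw [hrefl] at hN
  have hsplit := intervalIntegral.integral_Iic_add_Ioi (b := (0 : ℝ)) hint.integrableOn
    hint.integrableOn
  have habs : |∫ x, f x * Real.exp (-x ^ 2 / (2 * α ^ 2))| ≤
      ∫ x, |f x| * Real.exp (-x ^ 2 / (2 * α ^ 2)) := by
    refine (abs_integral_le_integral_abs).trans_eq ?_
    simp only [abs_mul, Real.abs_exp]
  have hc : 0 < Real.sqrt (2 * π) * α := by positivity
  set S := ∑ q ∈ Finset.range g, Real.exp (-(q : ℝ) ^ 2 / (2 * α ^ 2)) * B q
  have hconst : Real.sqrt 2 / (Real.sqrt π * α) = (Real.sqrt (2 * π) * α)⁻¹ * 2 := by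
    rw [Real.sqrt_mul zero_le_two]
    field_simp
    exact Real.sq_sqrt zero_le_two
  rw [Igauss, abs_mul, abs_of_pos (inv_pos.2 hc), hconst]
  calc (Real.sqrt (2 * π) * α)⁻¹ * |∫ x, f x * Real.exp (-x ^ 2 / (2 * α ^ 2))|
      ≤ (Real.sqrt (2 * π) * α)⁻¹ * (2 * (S + Real.exp (-(g : ℝ) ^ 2 / (2 * α ^ 2)) *
          (Real.sqrt (2 * π) * α / 2))) := by
        gcongr
        linarith
    _ = _ := by
        field_simp
        ring

lemma le_of_strict_increasing {n : ℕ → ℕ} (hmono : ∀ m, 1 ≤ m → n m < n (m + 1))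
    (hpos : ∀ m, 1 ≤ m → 1 ≤ n m) {m : ℕ} (hm : 1 ≤ m) : m ≤ n m := by
  induction m, hm using Nat.le_induction with
  | base => exact hpos 1 le_rfl
  | succ m hm ih => exact Nat.succ_le_of_lt (ih.trans_lt (hmono m hm))

lemma add_mem_Xk {Y : ℕ → Finset ℝ} {k q : ℕ} (hq : q < k) {y : ℝ} (hy : y ∈ Y (k - q)) :
    y + q ∈ Xk Y k ∧ y + (-(q + 1) : ℝ) ∈ Xk Y k := by
  have hi : k - (q + 1) + 1 = k - q := by omega
  simp only [Xk, Finset.mem_biUnion, Finset.mem_union, Finset.mem_image]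
  refine ⟨⟨q + 1, Finset.mem_Icc.2 (by omega), Or.inl ⟨y, by rwa [hi], by push_cast; ring⟩⟩,
    ⟨q + 1, Finset.mem_Icc.2 (by omega), Or.inr ⟨y, by rwa [hi], by push_cast; ring⟩⟩⟩

lemma sum_Icc_eq_sum_range_sub {k g : ℕ} (hgk : g ≤ k) (F : ℕ → ℝ) :
    ∑ m ∈ Finset.Icc (k - g + 1) k, F m = ∑ q ∈ Finset.range g, F (k - q) := by
  symm
  refine Finset.sum_bij' (fun q _ => k - q) (fun m _ => k - m) ?_ ?_ ?_ ?_ ?_ <;>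
    intro q hq <;> simp only [Finset.mem_range, Finset.mem_Icc] at hq ⊢ <;> omega

/-- generic bound on the optimal-weight worst-case error for the locally
quasi-uniform point sets X_k. -/
theorem stmt14 (α ℓ C h₀ cqu : ℝ) (hα : 0 < α) (hℓ : 0 < ℓ) (hC : 0 < C)
    (hh₀ : h₀ ∈ Set.Ioc (0 : ℝ) 1) (hcqu : 0 < cqu)
    (hsamp : ∀ (a : ℝ) (X : Finset ℝ), (∃ y ∈ X, y ∈ Set.Icc a (a + 1)) →
      fillDist1 X (Set.Icc a (a + 1)) ≤ h₀ →
      (∫ x in Set.Icc a (a + 1), power1 ℓ X x)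
        ≤ Real.exp (C * Real.log (fillDist1 X (Set.Icc a (a + 1))) /
            fillDist1 X (Set.Icc a (a + 1))))
    (nbar : ℕ → ℕ) (hmono : ∀ m, 1 ≤ m → nbar m < nbar (m + 1))
    (hpos : ∀ m, 1 ≤ m → 1 ≤ nbar m)
    (Y : ℕ → Finset ℝ)
    (hY : ∀ m, 1 ≤ m → (Y m : Set ℝ) ⊆ Set.Ioo (0 : ℝ) 1 ∧ (Y m).card = nbar m ∧
      fillDist1 (Y m) (Set.Ioo 0 1) ≤ cqu / (nbar m : ℝ))
    (k : ℕ) (hk : cqu / min h₀ cqu⁻¹ ≤ (k : ℝ))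
    (g : ℕ) (hg : (g : ℤ) = ⌊(k : ℝ) + 1 - cqu / min h₀ cqu⁻¹⌋) :
    eopt1 α ℓ (Xk Y k)
      ≤ Real.exp (-(g : ℝ) ^ 2 / (2 * α ^ 2)) +
        (Real.sqrt 2 / (Real.sqrt Real.pi * α)) *
          ∑ m ∈ Finset.Icc (k - g + 1) k,
            Real.exp (-(((k : ℝ) - (m : ℝ)) ^ 2 / (2 * α ^ 2) +
              C / (2 * cqu) * (nbar m : ℝ) * Real.log (nbar m))) := by
  set H : ℝ := min h₀ cqu⁻¹ with hHdef
  have hH : 0 < H := lt_min hh₀.1 (inv_pos.2 hcqu)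
  have hH1 : H ≤ 1 := (min_le_left _ _).trans hh₀.2
  have hc0 : 0 < cqu / H := div_pos hcqu hH
  have hcH : cqu ≤ cqu / H := le_div_self hcqu.le hH hH1
  have hcH2 : cqu ^ 2 ≤ cqu / H := by
    rw [le_div_iff₀ hH]
    calc cqu ^ 2 * H ≤ cqu ^ 2 * cqu⁻¹ := by gcongr; exact min_le_right _ _
      _ = cqu := by field_simp
  have hg1 : (g : ℝ) ≤ (k : ℝ) + 1 - cqu / H := by
    have h := Int.floor_le ((k : ℝ) + 1 - cqu / H)
    rw [← hg] at h
    exact_mod_cast h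
  have hgk : g ≤ k := by
    have : (g : ℝ) < (k : ℝ) + 1 := by linarith
    exact Nat.lt_succ_iff.1 (by exact_mod_cast this)
  have hnb : ∀ q < g, cqu / H ≤ (nbar (k - q) : ℝ) := fun q hq => by
    have h1 : ((k - q : ℕ) : ℝ) ≤ nbar (k - q) := by
      exact_mod_cast le_of_strict_increasing hmono hpos (by omega)
    rw [Nat.cast_sub (by omega)] at h1
    have h2 : (q : ℝ) + 1 ≤ g := by exact_mod_cast hq
    linarith
  refine eopt1_le_of_forall_vanishing hα hℓ (Xk Y k) fun f hf hX => ?_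
  have key : ∀ q < g, ∀ a : ℝ, (∀ y ∈ Y (k - q), y + a ∈ Xk Y k) →
      ∫ x in a..a + 1, |f x| ≤
        Real.exp (-(C / (2 * cqu) * (nbar (k - q) : ℝ) * Real.log (nbar (k - q)))) := by
    intro q hq a ha
    obtain ⟨hYsub, hYcard, hYfill⟩ := hY (k - q) (by omega)
    have hn : (0 : ℝ) < nbar (k - q) := hc0.trans_le (hnb q hq)
    have hne : (Y (k - q)).Nonempty :=
      Finset.card_pos.1 (by rw [hYcard]; exact hpos _ (by omega))
    have hfill := (fillDist1_Icc_le_of_translate hYsub hne ha).trans hYfill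
    obtain ⟨y, hy⟩ := hne
    have hyI : y + a ∈ Set.Icc a (a + 1) := by
      have := hYsub hy
      exact ⟨by linarith [this.1], by linarith [this.2]⟩
    have hnH : cqu / nbar (k - q) ≤ H := by
      rw [div_le_comm₀ hn hH]
      exact hnb q hq
    rw [intervalIntegral.integral_of_le (by linarith), ← integral_Icc_eq_integral_Ioc]
    refine (setIntegral_abs_le_setIntegral_power1 hℓ hf hX a (a + 1)).trans ?_
    refine (hsamp a (Xk Y k) ⟨_, ha y hy, hyI⟩
      (hfill.trans (hnH.trans (min_le_left _ _)))).trans ?_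
    exact exp_log_div_le hC hcqu hn (fillDist1_Icc_pos (by linarith) (ha y hy) hyI) hfill
      (hcH.trans (hnb q hq)) (hcH2.trans (hnb q hq))
  refine (abs_Igauss_le hα (hf.continuous hℓ) (hf.abs_le_one hℓ) g
    (fun q hq => key q hq q fun y hy => (add_mem_Xk (by omega) hy).1)
    (fun q hq => ?_)).trans_eq ?_
  · convert key q hq (-(q + 1)) fun y hy => (add_mem_Xk (by omega) hy).2 using 2
    ring
  · rw [sum_Icc_eq_sum_range_sub hgk]
    congr 2
    refine Finset.sum_congr rfl fun q hq => ?_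
    rw [← Real.exp_add, Nat.cast_sub ((Finset.mem_range.1 hq).le.trans hgk), sub_sub_cancel]
    congr 1
    ring

end
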